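/- Let (X, μ, T₁, T₂) be a system and let f be a bounded measurable function on X. If the box average of f with respect to (T₁, T₂) equals 0, then E(f | ℐ(T₁) ∨ ℐ(T₂)) = 0 μ-almost everywhere, where ℐ(T₁) ∨ ℐ(T₂) is the σ-algebra generated by the T₁-invariant sets together with the T₂-invariant sets. -/

import Mathlib

open MeasureTheory Filter

/-- The σ-algebra `ℐ(T)` of `T`-invariant measurable sets. -/
def invSigma {X : Type*} [m : MeasurableSpace X] (T : X → X) : MeasurableSpace X where
  MeasurableSet' s := MeasurableSet s ∧ T ⁻¹' s = s
  measurableSet_empty := ⟨MeasurableSet.empty, rfl⟩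
  measurableSet_compl s hs := ⟨hs.1.compl, by rw [Set.preimage_compl, hs.2]⟩
  measurableSet_iUnion f hf :=
    ⟨MeasurableSet.iUnion fun i => (hf i).1, by
      rw [Set.preimage_iUnion]
      exact Set.iUnion_congr fun i => (hf i).2⟩

/-- The box average of `f` with respect to `(T₁, T₂)` equals `L`: for every
`n₂` the inner Cesàro limit `c n₂` exists, and the Cesàro averages of `c`
converge to `L`. -/
def HasBoxAvg {X : Type*} [MeasurableSpace X] (μ : Measure X)
    (T₁ T₂ : X → X) (f : X → ℝ) (L : ℝ) : Prop :=
  ∃ c : ℕ → ℝ,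
    (∀ n₂ : ℕ, Tendsto (fun N₁ : ℕ =>
        (∑ n₁ ∈ Finset.range N₁,
          ∫ x, f x * f (T₁^[n₁] x) * f (T₂^[n₂] x) * f (T₁^[n₁] (T₂^[n₂] x)) ∂μ)
          / (N₁ : ℝ))
      atTop (nhds (c n₂))) ∧
    Tendsto (fun N₂ : ℕ => (∑ n₂ ∈ Finset.range N₂, c n₂) / (N₂ : ℝ))
      atTop (nhds L)

/-- If `U` is a linear isometry of a Hilbert space fixing `y` and the Cesàro averages of
`⟪x, Uⁿ x⟫` converge to `L`, then `⟪x, y⟫² ≤ L ‖y‖²`. -/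
lemma sq_inner_le_of_tendsto_average_inner_iterate
    {E : Type*} [NormedAddCommGroup E] [InnerProductSpace ℝ E] [CompleteSpace E]
    (U : E →ₗᵢ[ℝ] E) (x y : E) (hy : U y = y) {L : ℝ}
    (hL : Tendsto (fun N : ℕ => (∑ n ∈ Finset.range N, inner ℝ x (U^[n] x)) / (N : ℝ))
      atTop (nhds L)) :
    inner ℝ x y ^ 2 ≤ L * ‖y‖ ^ 2 := by
  let S := U.toContinuousLinearMap.eqLocus (1 : E →L[ℝ] E)
  let p : E := S.orthogonalProjectionOnto x
  have hlim : Tendsto (birkhoffAverage ℝ U _root_.id · x) atTop (nhds p) :=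
    U.toContinuousLinearMap.tendsto_birkhoffAverage_orthogonalProjection
      U.norm_toContinuousLinearMap_le x
  have hproj : ∀ z ∈ S, inner ℝ x z = inner ℝ p z := fun z hz => by
    have h0 : inner ℝ (x - p) z = 0 := S.starProjection_inner_eq_zero x z hz
    rw [inner_sub_left] at h0
    linarith
  have hyS : y ∈ S := by
    change U y = y
    exact hy
  have hpL : inner ℝ x p = L := by
    refine tendsto_nhds_unique (tendsto_const_nhds.inner hlim) (hL.congr fun N => ?_)
    rw [birkhoffAverage, birkhoffSum, inner_smul_right, inner_sum, div_eq_inv_mul]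
    rfl
  have hpp : L = ‖p‖ ^ 2 := by
    rw [← hpL, hproj p (Submodule.coe_mem _), real_inner_self_eq_norm_sq]
  rw [hproj y hyS, hpp, ← mul_pow]
  exact sq_le_sq' (neg_le_of_abs_le (abs_real_inner_le_norm p y)) (real_inner_le_norm p y)

/-- If `h` is invariant under the measure preserving map `T` and the autocorrelations
`∫ F · F ∘ Tⁿ` of `F` converge to `L` in the Cesàro sense, then `(∫ F h)² ≤ L ∫ h²`. -/
lemma sq_integral_mul_le_of_tendsto_average_autocorrelation
    {X : Type*} [MeasurableSpace X] {μ : Measure X} {T : X → X} (hT : MeasurePreserving T μ μ)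
    {F h : X → ℝ} (hF : MemLp F 2 μ) (hh : MemLp h 2 μ) (hinv : ∀ x, h (T x) = h x) {L : ℝ}
    (hL : Tendsto (fun N : ℕ => (∑ n ∈ Finset.range N, ∫ x, F x * F (T^[n] x) ∂μ) / (N : ℝ))
      atTop (nhds L)) :
    (∫ x, F x * h x ∂μ) ^ 2 ≤ L * ∫ x, h x ^ 2 ∂μ := by
  have hinner : ∀ {u v : X → ℝ} (hu : MemLp u 2 μ) (hv : MemLp v 2 μ),
      inner ℝ (hu.toLp u) (hv.toLp v) = ∫ x, u x * v x ∂μ := fun hu hv => by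
    rw [L2.inner_def]
    refine integral_congr_ae ?_
    filter_upwards [hu.coeFn_toLp, hv.coeFn_toLp] with x h1 h2
    simp [h1, h2, mul_comm]
  let U : Lp ℝ 2 μ →ₗᵢ[ℝ] Lp ℝ 2 μ := Lp.compMeasurePreservingₗᵢ ℝ T hT
  have hiter : ∀ n : ℕ, U^[n] (hF.toLp F) =
      (hF.comp_measurePreserving (hT.iterate n)).toLp (F ∘ T^[n]) := fun n => by
    induction n with
    | zero => rfl
    | succ n ih =>
      rw [Function.iterate_succ_apply', ih]
      exact Lp.toLp_compMeasurePreserving _ hT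
  have hfix : U (hh.toLp h) = hh.toLp h := by
    refine (Lp.toLp_compMeasurePreserving hh hT).trans ?_
    exact MemLp.toLp_congr _ _ (Eventually.of_forall hinv)
  have key := sq_inner_le_of_tendsto_average_inner_iterate U (hF.toLp F) (hh.toLp h) hfix (L := L)
    (by simpa only [hiter, hinner, Function.comp_apply] using hL)
  rw [hinner, ← real_inner_self_eq_norm_sq, hinner] at key
  simpa only [sq] using key

/-- A bounded function with vanishing box average is orthogonal to every product of a bounded
`T₁`-invariant function and a square-integrable `T₂`-invariant function. -/
lemma HasBoxAvg.integral_mul_invariant_mul_invariant_eq_zero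
    {X : Type*} [MeasurableSpace X] {μ : Measure X} [IsProbabilityMeasure μ] {T₁ T₂ : X → X}
    (h₁ : MeasurePreserving T₁ μ μ) (h₂ : MeasurePreserving T₂ μ μ)
    (hcomm : Function.Commute T₁ T₂) {f g h : X → ℝ}
    (hf : Measurable f) {C : ℝ} (hfC : ∀ x, |f x| ≤ C)
    (hg : Measurable g) (hg1 : ∀ x, |g x| ≤ 1) (hginv : ∀ x, g (T₁ x) = g x)
    (hh : MemLp h 2 μ) (hhinv : ∀ x, h (T₂ x) = h x)
    (hbox : HasBoxAvg μ T₁ T₂ f 0) :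
    ∫ x, f x * g x * h x ∂μ = 0 := by
  obtain ⟨c, hc, hc0⟩ := hbox
  have bdd : ∀ {u : X → ℝ} {D : ℝ}, Measurable u → (∀ x, |u x| ≤ D) → MemLp u 2 μ :=
    fun hu hD => MemLp.of_bound hu.aestronglyMeasurable _ (Eventually.of_forall hD)
  have hC : 0 ≤ C := by
    obtain ⟨x⟩ : Nonempty X := nonempty_of_isProbabilityMeasure μ
    exact (abs_nonneg _).trans (hfC x)
  let a : ℕ → ℝ := fun n => ∫ x, (f x * g x) * (f (T₂^[n] x) * g (T₂^[n] x)) ∂μ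
  have hac : ∀ n, a n ^ 2 ≤ c n := fun n => by
    have hm := (h₂.iterate n).measurable
    have hF : MemLp (fun x => f x * f (T₂^[n] x)) 2 μ :=
      bdd (D := C * C) (hf.mul (hf.comp hm)) fun x => by
        rw [abs_mul]; exact mul_le_mul (hfC _) (hfC _) (abs_nonneg _) hC
    have hk1 : ∀ x, |g x * g (T₂^[n] x)| ≤ 1 := fun x => by
      rw [abs_mul]; exact mul_le_one₀ (hg1 _) (abs_nonneg _) (hg1 _)
    have hk : MemLp (fun x => g x * g (T₂^[n] x)) 2 μ := bdd (hg.mul (hg.comp hm)) hk1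
    have hav : Tendsto (fun N : ℕ => (∑ m ∈ Finset.range N, ∫ x, (f x * f (T₂^[n] x)) *
        (f (T₁^[m] x) * f (T₂^[n] (T₁^[m] x))) ∂μ) / (N : ℝ)) atTop (nhds (c n)) := by
      refine (hc n).congr fun N => ?_
      congr 1
      refine Finset.sum_congr rfl fun m _ => integral_congr_ae (Eventually.of_forall fun x => ?_)
      have := (hcomm.iterate_iterate m n) x
      simp only [this]
      ring
    have key := sq_integral_mul_le_of_tendsto_average_autocorrelation h₁ hF hk
      (fun x => by rw [hginv, ← (hcomm.iterate_right n) x, hginv]) hav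
    have hcn : 0 ≤ c n := by
      have h1 := sq_integral_mul_le_of_tendsto_average_autocorrelation h₁ hF
        (memLp_const (1 : ℝ)) (fun _ => rfl) hav
      simp only [one_pow, integral_const, probReal_univ, smul_eq_mul, mul_one] at h1
      exact (sq_nonneg _).trans h1
    have hint : ∫ x, (g x * g (T₂^[n] x)) ^ 2 ∂μ ≤ 1 := by
      calc ∫ x, (g x * g (T₂^[n] x)) ^ 2 ∂μ ≤ ∫ _, (1 : ℝ) ∂μ :=
            integral_mono hk.integrable_sq (integrable_const 1) fun x => by
              simpa using (sq_le_one_iff_abs_le_one _).2 (hk1 x)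
        _ = 1 := by simp
    have ha : a n = ∫ x, (f x * f (T₂^[n] x)) * (g x * g (T₂^[n] x)) ∂μ :=
      integral_congr_ae (Eventually.of_forall fun x => by ring)
    rw [ha]
    exact key.trans (mul_le_of_le_one_right hcn hint)
  have hsq : Tendsto (fun N : ℕ => ((∑ n ∈ Finset.range N, a n) / (N : ℝ)) ^ 2)
      atTop (nhds 0) := by
    refine squeeze_zero (fun _ => sq_nonneg _) (fun N => ?_) hc0
    calc ((∑ n ∈ Finset.range N, a n) / (N : ℝ)) ^ 2
        ≤ (∑ n ∈ Finset.range N, a n ^ 2) / (N : ℝ) := by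
          simpa using sum_div_card_sq_le_sum_sq_div_card (s := Finset.range N) (f := a)
      _ ≤ _ := by gcongr with n; exact hac n
  have ha0 : Tendsto (fun N : ℕ => (∑ n ∈ Finset.range N, a n) / (N : ℝ)) atTop (nhds 0) := by
    refine (tendsto_zero_iff_abs_tendsto_zero _).2 ?_
    simpa [Real.sqrt_sq_eq_abs, Function.comp_def] using hsq.sqrt
  have key := sq_integral_mul_le_of_tendsto_average_autocorrelation h₂
    (bdd (D := C * 1) (hf.mul hg) fun x => by
      rw [Pi.mul_apply, abs_mul]; exact mul_le_mul (hfC _) (hg1 _) (abs_nonneg _) hC) hh hhinv ha0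
  rw [zero_mul] at key
  exact pow_eq_zero_iff two_ne_zero |>.1 (le_antisymm key (sq_nonneg _))

lemma invSigma_le {X : Type*} [m : MeasurableSpace X] (T : X → X) : invSigma T ≤ m :=
  fun _ hs => hs.1

/-- Intersections of members of two σ-algebras form a π-system. -/
lemma isPiSystem_image2_inter {X : Type*} (m₁ m₂ : MeasurableSpace X) :
    IsPiSystem (Set.image2 (· ∩ ·) {s | MeasurableSet[m₁] s} {t | MeasurableSet[m₂] t}) := by
  rintro _ ⟨s, hs, t, ht, rfl⟩ _ ⟨s', hs', t', ht', rfl⟩ -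
  exact ⟨s ∩ s', MeasurableSet.inter hs hs', t ∩ t', MeasurableSet.inter ht ht',
    Set.inter_inter_inter_comm ..⟩

/-- The join of two σ-algebras is generated by the intersections of their members. -/
lemma sup_eq_generateFrom_image2_inter {X : Type*} (m₁ m₂ : MeasurableSpace X) :
    m₁ ⊔ m₂ = MeasurableSpace.generateFrom
      (Set.image2 (· ∩ ·) {s | MeasurableSet[m₁] s} {t | MeasurableSet[m₂] t}) := by
  refine le_antisymm (sup_le (fun s hs => ?_) fun t ht => ?_) (MeasurableSpace.generateFrom_le ?_)
  · exact .basic _ ⟨s, hs, Set.univ, MeasurableSet.univ, Set.inter_univ s⟩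
  · exact .basic _ ⟨Set.univ, MeasurableSet.univ, t, ht, Set.univ_inter t⟩
  · rintro _ ⟨s, hs, t, ht, rfl⟩
    exact MeasurableSet.inter ((le_sup_left : m₁ ≤ m₁ ⊔ m₂) _ hs)
      ((le_sup_right : m₂ ≤ m₁ ⊔ m₂) _ ht)

theorem condexp_vanishes_of_box_seminorm_zero
    {X : Type*} [mX : MeasurableSpace X] (μ : Measure X) [IsProbabilityMeasure μ]
    (T₁ T₂ : X ≃ᵐ X)
    (h₁ : MeasurePreserving T₁ μ μ) (h₂ : MeasurePreserving T₂ μ μ)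
    (hcomm : ∀ x, T₁ (T₂ x) = T₂ (T₁ x))
    (f : X → ℝ) (hf : Measurable f) (hfb : ∃ C : ℝ, ∀ x, |f x| ≤ C)
    (hbox : HasBoxAvg μ ⇑T₁ ⇑T₂ f 0) :
    μ[f | invSigma ⇑T₁ ⊔ invSigma ⇑T₂] =ᵐ[μ] 0 := by
  obtain ⟨C, hC⟩ := hfb
  have hle : invSigma ⇑T₁ ⊔ invSigma ⇑T₂ ≤ mX := sup_le (invSigma_le _) (invSigma_le _)
  have hfi : Integrable f μ :=
    Integrable.of_bound hf.aestronglyMeasurable C (Eventually.of_forall hC)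
  have hinter : ∀ A B : Set X, MeasurableSet[invSigma ⇑T₁] A → MeasurableSet[invSigma ⇑T₂] B →
      ∫ x in A ∩ B, f x ∂μ = 0 := fun A B hA hB => by
    have hB2 : MemLp (B.indicator 1 : X → ℝ) 2 μ :=
      memLp_indicator_const 2 hB.1 (1 : ℝ) (Or.inr (measure_ne_top μ B))
    have key := hbox.integral_mul_invariant_mul_invariant_eq_zero h₁ h₂ hcomm hf hC
      (g := A.indicator 1) (h := B.indicator 1) (measurable_one.indicator hA.1)
      (fun x => by by_cases hx : x ∈ A <;> simp [hx])
      (fun x => by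
        conv_rhs => rw [← hA.2]
        rfl) hB2
      (fun x => by
        conv_rhs => rw [← hB.2]
        rfl)
    rw [← integral_indicator (hA.1.inter hB.1), ← key]
    refine integral_congr_ae (Eventually.of_forall fun x => ?_)
    by_cases hxA : x ∈ A <;> by_cases hxB : x ∈ B <;> simp [hxA, hxB]
  have hset : ∀ s, MeasurableSet[invSigma ⇑T₁ ⊔ invSigma ⇑T₂] s → ∫ x in s, f x ∂μ = 0 := by
    refine MeasurableSpace.induction_on_inter (sup_eq_generateFrom_image2_inter _ _)
      (isPiSystem_image2_inter _ _) (by simp) ?_ ?_ ?_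
    · rintro _ ⟨A, hA, B, hB, rfl⟩
      exact hinter A B hA hB
    · intro t ht h0
      have huniv := hinter Set.univ Set.univ .univ .univ
      rw [Set.univ_inter, setIntegral_univ] at huniv
      rw [setIntegral_compl (hle _ ht) hfi, huniv, h0, sub_zero]
    · intro s hd hs h0
      rw [integral_iUnion (fun i => hle _ (hs i)) hd hfi.integrableOn]
      simp [h0]
  refine (ae_eq_condExp_of_forall_setIntegral_eq hle hfi (fun _ _ _ => integrableOn_zero)
    (fun s hs _ => ?_) aestronglyMeasurable_zero).symm
  rw [hset s hs]
  simp
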